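/- Let T be a type, s : List T, u v : List T, k r : ℕ with r ≥ 2. Suppose there are indices i₁ < … < i_r and words w₁, …, w_r, each of length exactly k, such that the factors u ++ w_j ++ v occur in s at positions i_j without overlap (i_{j+1} ≥ i_j + |u| + k + |v|, i_r + |u| + k + |v| ≤ |s|, and the sublist of s at positions [i_j, i_j + |u| + k + |v|) equals u ++ w_j ++ v for each j). Then there exists a non-recursive context-free grammar G over T with nonterminal type Fin 3 such that: (i) s ∈ G.language; (ii) G.language is finite; (iii) the rules of G are a start rule whose right-hand side has length |s| − r·(|u| + |v| + k − 1), one rule with right-hand side u ++ [I] ++ v for an 'inside' nonterminal I, and for each distinct word among w₁, …, w_r one rule rewriting I to that word. (This is the grammar construction underlying the fixed-length motif u.ᵏv replacement of the NRGreedy_fix algorithm.) -/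

import Mathlib

namespace ContextFreeRule

variable {T N : Type*}

/-- The total weight of a string, where nonterminals are weighted by `wt` and terminals by `0`. -/
def weight (wt : N → ℕ) (x : List (Symbol T N)) : ℕ :=
  (x.map fun | .terminal _ => 0 | .nonterminal A => wt A).sum

@[simp]
lemma weight_append (wt : N → ℕ) (x y : List (Symbol T N)) :
    weight wt (x ++ y) = weight wt x + weight wt y := by
  simp [weight]

@[simp]
lemma weight_nil (wt : N → ℕ) : weight wt ([] : List (Symbol T N)) = 0 :=
  rfl

@[simp]
lemma weight_nonterminal_cons (wt : N → ℕ) (A : N) (x : List (Symbol T N)) :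
    weight wt (.nonterminal A :: x) = wt A + weight wt x := by
  simp [weight]

@[simp]
lemma weight_map_terminal (wt : N → ℕ) (x : List T) :
    weight wt (x.map Symbol.terminal) = 0 := by
  simp [weight, Function.comp_def]

lemma le_weight_of_mem (wt : N → ℕ) {A : N} {x : List (Symbol T N)}
    (h : .nonterminal A ∈ x) : wt A ≤ weight wt x := by
  obtain ⟨p, q, rfl⟩ := List.append_of_mem h
  rw [weight_append, weight_nonterminal_cons]
  omega

lemma Rewrites.weight_lt {wt : N → ℕ} {r : ContextFreeRule T N} {x y : List (Symbol T N)}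
    (h : r.Rewrites x y) (hr : weight wt r.output < wt r.input) : weight wt y < weight wt x := by
  obtain ⟨p, q, rfl, rfl⟩ := h.exists_parts
  simpa using hr

lemma finite_setOf_rewrites (r : ContextFreeRule T N) (x : List (Symbol T N)) :
    {y | r.Rewrites x y}.Finite := by
  induction x with
  | nil =>
    refine Set.finite_empty.subset fun y hy => ?_
    cases hy
  | cons a x ih =>
    refine ((Set.finite_singleton (r.output ++ x)).union (ih.image (a :: ·))).subset fun y hy => ?_
    cases hy with
    | head => exact .inl rfl
    | cons _ h => exact .inr ⟨_, h, rfl⟩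

end ContextFreeRule

namespace ContextFreeGrammar

variable {T : Type*} {g : ContextFreeGrammar T} {wt : g.NT → ℕ}

open ContextFreeRule

lemma finite_setOf_produces (g : ContextFreeGrammar T) (x : List (Symbol T g.NT)) :
    {y | g.Produces x y}.Finite := by
  refine (g.rules.finite_toSet.biUnion fun r _ => finite_setOf_rewrites r x).subset ?_
  rintro y ⟨r, hr, h⟩
  exact Set.mem_biUnion hr h

lemma Produces.weight_lt (hwt : ∀ r ∈ g.rules, weight wt r.output < wt r.input)
    {x y : List (Symbol T g.NT)} (h : g.Produces x y) : weight wt y < weight wt x :=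
  let ⟨r, hr, hxy⟩ := h
  hxy.weight_lt (hwt r hr)

/-- A grammar whose rules all decrease the weight is non-recursive. -/
lemma nonterminal_notMem_of_transGen (hwt : ∀ r ∈ g.rules, weight wt r.output < wt r.input)
    {A : g.NT} {x : List (Symbol T g.NT)}
    (h : Relation.TransGen g.Produces [.nonterminal A] x) : .nonterminal A ∉ x := by
  have key : weight wt x < weight wt ([.nonterminal A] : List (Symbol T g.NT)) := by
    induction h with
    | single h => exact h.weight_lt hwt
    | tail _ h ih => exact (h.weight_lt hwt).trans ih
  intro hA
  have := le_weight_of_mem wt hA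
  rw [weight_nonterminal_cons, weight_nil] at key
  omega

/-- A grammar whose rules all decrease the weight derives finitely many strings. -/
lemma finite_setOf_derives (hwt : ∀ r ∈ g.rules, weight wt r.output < wt r.input)
    (x : List (Symbol T g.NT)) : {y | g.Derives x y}.Finite := by
  induction hn : weight wt x using Nat.strong_induction_on generalizing x with
  | _ n ih =>
    subst hn
    refine ((Set.finite_singleton x).union ((g.finite_setOf_produces x).biUnion
      fun y hy => ih _ (Produces.weight_lt hwt hy) y rfl)).subset fun z hz => ?_
    rcases Derives.eq_or_head hz with rfl | ⟨y, hxy, hyz⟩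
    · exact .inl rfl
    · exact .inr (Set.mem_biUnion hxy hyz)

lemma finite_language (hwt : ∀ r ∈ g.rules, weight wt r.output < wt r.input) :
    (g.language : Set (List T)).Finite :=
  (finite_setOf_derives hwt _).preimage
    (List.map_injective_iff.2 fun _ _ h => Symbol.terminal.inj h).injOn

/-- Non-overlapping factors of positive length `L` of a word can be replaced by a nonterminal `A`;
the word is derived back as soon as each of the factors is derived from `A`. -/
lemma exists_replace_factors {N : Type} (A : N) {L : ℕ} (hL : 0 < L) (r : ℕ) (s : List T)
    (i : Fin r → ℕ)
    (hsep : ∀ j₁ j₂ : Fin r, j₁ < j₂ → i j₁ + L ≤ i j₂)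
    (hbound : ∀ j, i j + L ≤ s.length) :
    ∃ x : List (Symbol T N),
      x.length + r * (L - 1) = s.length ∧
      (∀ B, .nonterminal B ∈ x → B = A) ∧
      ∀ (init : N) (rules : Finset (ContextFreeRule T N)),
        (∀ j, (ContextFreeGrammar.mk N init rules).Derives [.nonterminal A]
          (((s.drop (i j)).take L).map .terminal)) →
        (ContextFreeGrammar.mk N init rules).Derives x (s.map .terminal) := by
  induction r generalizing s with
  | zero => exact ⟨s.map .terminal, by simp, by simp, fun _ _ _ => .refl _⟩
  | succ r ih =>
    have hlast := hbound (Fin.last r)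
    have hinit (j : Fin r) : i j.castSucc + L ≤ i (Fin.last r) :=
      hsep _ _ (Fin.castSucc_lt_last j)
    obtain ⟨x, hlen, hA, hder⟩ := ih (s.take (i (Fin.last r))) (fun j => i j.castSucc)
      (fun j₁ j₂ h => hsep _ _ (by simpa using h))
      (fun j => by have := hinit j; rw [List.length_take]; omega)
    refine ⟨x ++ [.nonterminal A] ++ (s.drop (i (Fin.last r) + L)).map .terminal, ?_, ?_, ?_⟩
    · rw [List.length_take] at hlen
      simp only [List.length_append, List.length_map, List.length_drop, List.length_singleton,
        Nat.succ_mul]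
      omega
    · intro B hB
      simp only [List.mem_append, List.mem_singleton, Symbol.nonterminal.injEq, List.mem_map,
        reduceCtorEq, and_false, exists_false, or_false] at hB
      exact hB.elim (hA B) id
    · intro init rules h
      have hs : s = s.take (i (Fin.last r)) ++ (s.drop (i (Fin.last r))).take L ++
          s.drop (i (Fin.last r) + L) := by
        rw [List.append_assoc, ← List.drop_drop, List.take_append_drop, List.take_append_drop]
      have hx := hder init rules fun j => by
        have := hinit j
        rw [List.drop_take, List.take_take, min_eq_left (by omega)]
        exact h j.castSucc
      conv => arg 3; rw [hs]
      rw [List.map_append, List.map_append]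
      exact ((hx.append_right _).trans ((h (Fin.last r)).append_left _)).append_right _

end ContextFreeGrammar


/-- The grammar construction underlying the fixed-length motif `u.ᵏv` replacement: given `r ≥ 2`
non-overlapping occurrences `u ++ wⱼ ++ v` (with `|wⱼ| = k`) in `s`, there is a non-recursive
grammar over nonterminals `Fin 3` containing `s` in its (finite) language, whose rules are a
start rule of right-hand-side length `|s| - r·(|u| + |v| + k - 1)`, an outside rule with
right-hand side `u ++ [I] ++ v`, and one rule `I → wⱼ` for each distinct word among the `wⱼ`. -/
theorem fixed_length_motif_grammar {T : Type*} (s u v : List T) (k r : ℕ) (hr : 2 ≤ r)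
    (i : Fin r → ℕ) (w : Fin r → List T)
    (hk : ∀ j : Fin r, (w j).length = k)
    (hstrict : StrictMono i)
    (hsep : ∀ j₁ j₂ : Fin r, j₁ < j₂ → i j₁ + (u.length + k + v.length) ≤ i j₂)
    (hbound : ∀ j : Fin r, i j + (u.length + k + v.length) ≤ s.length)
    (hocc : ∀ j : Fin r, (s.drop (i j)).take (u.length + k + v.length) = u ++ w j ++ v) :
    ∃ (init : Fin 3) (rules : Finset (ContextFreeRule T (Fin 3))),
      (∀ A : Fin 3, ∀ x : List (Symbol T (Fin 3)),
        Relation.TransGen (ContextFreeGrammar.mk (Fin 3) init rules).Produces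
          [Symbol.nonterminal A] x → Symbol.nonterminal A ∉ x) ∧
      s ∈ (ContextFreeGrammar.mk (Fin 3) init rules).language ∧
      ((ContextFreeGrammar.mk (Fin 3) init rules).language : Set (List T)).Finite ∧
      ∃ (startRule outsideRule : ContextFreeRule T (Fin 3)) (I : Fin 3),
        startRule.input = init ∧
        startRule.output.length = s.length - r * (u.length + v.length + k - 1) ∧
        outsideRule.output =
          u.map Symbol.terminal ++ [Symbol.nonterminal I] ++ v.map Symbol.terminal ∧
        ∀ rl : ContextFreeRule T (Fin 3),
          rl ∈ rules ↔ rl = startRule ∨ rl = outsideRule ∨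
            ∃ j : Fin r, rl = ⟨I, (w j).map Symbol.terminal⟩ := by
  obtain ⟨x, hx, hx1, hder⟩ : ∃ x : List (Symbol T (Fin 3)),
      x.length = s.length - r * (u.length + v.length + k - 1) ∧
      (∀ B, .nonterminal B ∈ x → B = 1) ∧
      ∀ (init : Fin 3) (rules : Finset (ContextFreeRule T (Fin 3))),
        (∀ j, (ContextFreeGrammar.mk (Fin 3) init rules).Derives [.nonterminal 1]
          ((u ++ w j ++ v).map .terminal)) →
        (ContextFreeGrammar.mk (Fin 3) init rules).Derives x (s.map .terminal) := by
    rcases Nat.eq_zero_or_pos (u.length + k + v.length) with h0 | hL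
    · refine ⟨s.map .terminal, ?_, by simp, fun _ _ _ => .refl _⟩
      rw [show u.length + v.length + k - 1 = 0 by omega]
      simp
    · obtain ⟨x, hx, hx1, hder⟩ :=
        ContextFreeGrammar.exists_replace_factors (1 : Fin 3) hL r s i hsep hbound
      refine ⟨x, ?_, hx1, fun init rules h => hder init rules fun j => by rw [hocc]; exact h j⟩
      rw [show u.length + v.length + k = u.length + k + v.length by omega]
      omega
  let startRule : ContextFreeRule T (Fin 3) := ⟨0, x⟩
  let outsideRule : ContextFreeRule T (Fin 3) :=
    ⟨1, u.map .terminal ++ [.nonterminal 2] ++ v.map .terminal⟩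
  let insideRule (j : Fin r) : ContextFreeRule T (Fin 3) := ⟨2, (w j).map .terminal⟩
  let rules : Finset (ContextFreeRule T (Fin 3)) :=
    (Set.toFinite ({startRule, outsideRule} ∪ Set.range insideRule)).toFinset
  have hrules (rl : ContextFreeRule T (Fin 3)) :
      rl ∈ rules ↔ rl = startRule ∨ rl = outsideRule ∨ ∃ j, rl = insideRule j := by
    simp only [rules, Set.Finite.mem_toFinset, Set.mem_union, Set.mem_insert_iff,
      Set.mem_singleton_iff, Set.mem_range, or_assoc, eq_comm (a := rl)]
  let g := ContextFreeGrammar.mk (Fin 3) 0 rules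
  let wt : Fin 3 → ℕ := ![ContextFreeRule.weight (fun _ => 2) x + 1, 2, 1]
  have hwt : ∀ rl ∈ g.rules, ContextFreeRule.weight wt rl.output < wt rl.input := by
    intro rl hrl
    rcases (hrules rl).1 hrl with rfl | rfl | ⟨j, rfl⟩
    · refine Nat.lt_succ_of_le (le_of_eq ?_)
      refine congrArg List.sum (List.map_congr_left ?_)
      rintro (t | B) hB
      · rfl
      · rw [hx1 B hB]
        rfl
    · simp [outsideRule, wt]
    · simp [insideRule, wt]
  have produces {rl : ContextFreeRule T (Fin 3)} (h : rl ∈ rules) :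
      g.Produces [.nonterminal rl.input] rl.output :=
    ⟨rl, h, .input_output⟩
  have hstart : g.Produces [.nonterminal 0] x := produces ((hrules startRule).2 (.inl rfl))
  have houtside : g.Produces [.nonterminal 1] outsideRule.output :=
    produces ((hrules outsideRule).2 (.inr (.inl rfl)))
  have hinside (j : Fin r) : g.Produces [.nonterminal 2] ((w j).map .terminal) :=
    produces ((hrules (insideRule j)).2 (.inr (.inr ⟨j, rfl⟩)))
  refine ⟨0, rules, fun A y h => ContextFreeGrammar.nonterminal_notMem_of_transGen hwt h, ?_,
    ContextFreeGrammar.finite_language hwt, startRule, outsideRule, 2, rfl, hx, rfl, hrules⟩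
  refine hstart.single.trans (hder 0 rules fun j => houtside.single.trans ?_)
  rw [List.map_append, List.map_append]
  exact (((hinside j).append_left _).append_right _).single
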